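/- arXiv:1809.02332 — 6 statements merged into one kernel-verified Lean document; each statement's English description precedes it below -/
import Mathlib

section
/- Let n ≥ 1 be an integer, 0 < r < 1, c ∈ ℝ, and let ε_1,…,ε_n ∈ {0,1}. Define f : ℝⁿ → ℝ by f(w_1,…,w_n) = Σ_{i=1}^n (−1)^{ε_i} w_i² + c. If g : ℝⁿ → ℝ is a C² function satisfying ‖g − f‖_{2,B(r)} < r/n, then there exists exactly one point x in the open ball B(r) with Dg(x) = 0 (i.e., g has a unique critical point in B(r)). -/
/-- **Uniqueness of the critical point of a small perturbation of a quadratic Morse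
function.**  Let `f w = ∑ i, (-1)^(ε i) * (w i)^2 + c` on `ℝⁿ` (with `ε i ∈ {0,1}`),
let `0 < r < 1`, and let `g` be a `C²` function with `‖g - f‖_{2, B(r)} < r / n`
(stated pointwise on the open ball `B(r)`).  Then `g` has a unique critical point in
the open ball `B(r)`. -/
theorem stmt_0 (n : ℕ) (hn : 1 ≤ n) (r c : ℝ) (hr0 : 0 < r) (hr1 : r < 1)
    (ε : Fin n → ℕ) (hε : ∀ i, ε i ≤ 1)
    (f g : EuclideanSpace ℝ (Fin n) → ℝ)
    (hf : ∀ w, f w = (∑ i, (-1 : ℝ) ^ (ε i) * (w i) ^ 2) + c)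
    (hg : ContDiff ℝ 2 g)
    (hclose : ∀ x ∈ Metric.ball (0 : EuclideanSpace ℝ (Fin n)) r,
      |g x - f x| + ‖fderiv ℝ g x - fderiv ℝ f x‖
        + ‖iteratedFDeriv ℝ 2 g x - iteratedFDeriv ℝ 2 f x‖ < r / n) :
    ∃! x, x ∈ Metric.ball (0 : EuclideanSpace ℝ (Fin n)) r ∧ fderiv ℝ g x = 0 := by
  classical
  have hs : ∀ i, ((-1 : ℝ) ^ (ε i)) * ((-1 : ℝ) ^ (ε i)) = 1 := by
    intro i
    rw [← mul_pow]; norm_num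
  obtain ⟨S, hSdef⟩ : ∃ S : EuclideanSpace ℝ (Fin n) → EuclideanSpace ℝ (Fin n),
      ∀ v i, S v i = (-1 : ℝ) ^ (ε i) * v i :=
    ⟨fun v => WithLp.toLp 2 (fun i => (-1 : ℝ) ^ (ε i) * v i), fun v i => rfl⟩
  have hSnorm : ∀ v, ‖S v‖ = ‖v‖ := by
    intro v
    rw [EuclideanSpace.norm_eq, EuclideanSpace.norm_eq]
    congr 1
    refine Finset.sum_congr rfl fun i _ => ?_
    rw [hSdef, norm_mul, norm_pow]; simp
  have hSsub : ∀ v w, S (v - w) = S v - S w := by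
    intro v w; ext i; simp [hSdef, mul_sub]
  have hfd : ∀ x, HasFDerivAt f
      (InnerProductSpace.toDual ℝ (EuclideanSpace ℝ (Fin n)) ((2 : ℝ) • S x)) x := by
    intro x
    have h1 : ∀ i : Fin n, HasFDerivAt (fun w : EuclideanSpace ℝ (Fin n) => w i)
        (EuclideanSpace.proj i : EuclideanSpace ℝ (Fin n) →L[ℝ] ℝ) x := fun i =>
      (EuclideanSpace.proj i : EuclideanSpace ℝ (Fin n) →L[ℝ] ℝ).hasFDerivAt
    have h2 := (HasFDerivAt.fun_sum (u := Finset.univ)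
      (fun i _ => ((h1 i).pow 2).const_mul ((-1 : ℝ) ^ (ε i)))).add_const c
    have hff : f = fun w => (∑ i, (-1 : ℝ) ^ (ε i) * (w i) ^ 2) + c := funext hf
    rw [hff]
    refine h2.congr_fderiv ?_
    ext v
    simp only [InnerProductSpace.toDual_apply_apply, PiLp.inner_apply, ContinuousLinearMap.sum_apply]
    refine Finset.sum_congr rfl fun i _ => ?_
    simp [hSdef]
    ring
  have hfC : ContDiff ℝ 2 f := by
    have hff : f = fun w => (∑ i, (-1 : ℝ) ^ (ε i) * (w i) ^ 2) + c := funext hf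
    rw [hff]
    fun_prop
  set h : EuclideanSpace ℝ (Fin n) → ℝ := g - f with hh
  have hhC : ContDiff ℝ 2 h := hg.sub hfC
  have hgd : ∀ x, DifferentiableAt ℝ g x := fun x => (hg.differentiable (by norm_num)) x
  have hfderiv : ∀ x, fderiv ℝ h x = fderiv ℝ g x - fderiv ℝ f x := fun x =>
    fderiv_sub (hgd x) (hfd x).differentiableAt
  have hrn : r / n ≤ r := div_le_self hr0.le (by exact_mod_cast hn)
  have hb1 : ∀ x ∈ Metric.ball (0 : EuclideanSpace ℝ (Fin n)) r, ‖fderiv ℝ h x‖ ≤ r := by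
    intro x hx
    have := hclose x hx
    rw [hfderiv]
    have a1 := abs_nonneg (g x - f x)
    have a2 := norm_nonneg (iteratedFDeriv ℝ 2 g x - iteratedFDeriv ℝ 2 f x)
    linarith
  have hb2 : ∀ x ∈ Metric.ball (0 : EuclideanSpace ℝ (Fin n)) r,
      ‖fderiv ℝ (fderiv ℝ h) x‖ ≤ 1 := by
    intro x hx
    have := hclose x hx
    rw [← norm_iteratedFDeriv_one, norm_iteratedFDeriv_fderiv, hh,
      iteratedFDeriv_sub_apply hg.contDiffAt hfC.contDiffAt]
    have a1 := abs_nonneg (g x - f x)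
    have a2 := norm_nonneg (fderiv ℝ g x - fderiv ℝ f x)
    norm_num
    linarith
  have hlip : ∀ x ∈ Metric.ball (0 : EuclideanSpace ℝ (Fin n)) r,
      ∀ y ∈ Metric.ball (0 : EuclideanSpace ℝ (Fin n)) r,
      ‖fderiv ℝ h y - fderiv ℝ h x‖ ≤ 1 * ‖y - x‖ := by
    intro x hx y hy
    refine Convex.norm_image_sub_le_of_norm_fderiv_le (𝕜 := ℝ) ?_ hb2 (convex_ball _ _) hx hy
    intro z _
    exact ((hhC.fderiv_right (m := 1) (by norm_num)).differentiable (by norm_num)) z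
  let D := (InnerProductSpace.toDual ℝ (EuclideanSpace ℝ (Fin n)))
  obtain ⟨T, hT⟩ : ∃ T : EuclideanSpace ℝ (Fin n) → EuclideanSpace ℝ (Fin n),
      ∀ x, T x = (-(1/2) : ℝ) • S (D.symm (fderiv ℝ h x)) := ⟨_, fun _ => rfl⟩
  have hTn : ∀ x, ‖T x‖ = 1/2 * ‖fderiv ℝ h x‖ := by
    intro x
    rw [hT, norm_smul, hSnorm, LinearIsometryEquiv.norm_map]; norm_num
  have hTl : ∀ x y, ‖T x - T y‖ = 1/2 * ‖fderiv ℝ h x - fderiv ℝ h y‖ := by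
    intro x y
    rw [hT, hT, ← smul_sub, ← hSsub, ← map_sub, norm_smul, hSnorm,
      LinearIsometryEquiv.norm_map]; norm_num
  have hcrit : ∀ x, fderiv ℝ g x = 0 ↔ T x = x := by
    intro x
    have e1 : fderiv ℝ g x = D ((2 : ℝ) • S x + D.symm (fderiv ℝ h x)) := by
      rw [map_add, LinearIsometryEquiv.apply_symm_apply, hfderiv, (hfd x).fderiv]
      simp [D]
    rw [e1, LinearIsometryEquiv.map_eq_zero_iff, hT]
    generalize D.symm (fderiv ℝ h x) = v
    constructor
    · intro e
      ext i
      have := congrArg (fun w : EuclideanSpace ℝ (Fin n) => w i) e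
      simp [hSdef] at this ⊢
      have h3 := hs i
      linear_combination (-(1/2) * (-1 : ℝ) ^ ε i) * this + x i * h3
    · intro e
      ext i
      have := congrArg (fun w : EuclideanSpace ℝ (Fin n) => w i) e
      simp [hSdef] at this ⊢
      have h3 := hs i
      linear_combination (-2 * (-1 : ℝ) ^ ε i) * this - v i * h3
  have hsub : Metric.closedBall (0 : EuclideanSpace ℝ (Fin n)) (r/2) ⊆ Metric.ball 0 r :=
    Metric.closedBall_subset_ball (by linarith)
  have hmaps : Set.MapsTo T (Metric.closedBall 0 (r/2)) (Metric.closedBall 0 (r/2)) := by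
    intro x hx
    rw [mem_closedBall_zero_iff, hTn]
    linarith [hb1 x (hsub hx)]
  have hcon : ContractingWith (1/2) (hmaps.restrict T _ _) := by
    refine ⟨by rw [← NNReal.coe_lt_coe]; norm_num, LipschitzWith.of_dist_le_mul ?_⟩
    rintro ⟨x, hx⟩ ⟨y, hy⟩
    rw [Subtype.dist_eq, Subtype.dist_eq]
    simp only [Set.MapsTo.val_restrict_apply, dist_eq_norm]
    rw [hTl]
    have := hlip y (hsub hy) x (hsub hx)
    push_cast
    linarith
  obtain ⟨x, hx, hfix, -⟩ := hcon.exists_fixedPoint' Metric.isClosed_closedBall.isComplete hmaps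
    (x := 0) (Metric.mem_closedBall_self (by linarith)) (edist_ne_top _ _)
  refine ⟨x, ⟨hsub hx, (hcrit x).2 hfix⟩, ?_⟩
  rintro y ⟨hy, hy0⟩
  have e2 := (hcrit y).1 hy0
  have e3 := hTl y x
  rw [e2, hfix.eq] at e3
  have e4 := hlip x (hsub hx) y hy
  have e5 : ‖y - x‖ = 0 := le_antisymm (by linarith) (norm_nonneg _)
  exact sub_eq_zero.1 (norm_eq_zero.1 e5)
end

section
/- Let n ≥ 1 be an integer, 0 < r < 1, c ∈ ℝ, ε_1,…,ε_n ∈ {0,1}, and f(w) = Σ_{i=1}^n (−1)^{ε_i} w_i² + c on ℝⁿ. Suppose g, h : ℝⁿ → ℝ are C² functions with ‖g − f‖_{2,B(r)} < r/n and ‖h − f‖_{2,B(r)} < r/n, let x_g ∈ B(r) and x_h ∈ B(r) be critical points of g and of h respectively, and suppose x_g and x_h both lie in a convex set U ⊆ B(r). Then ‖x_g − x_h‖ ≤ √n · ‖g − h‖_{1,U}. -/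
/-- **Estimate on the distance between critical points of two small perturbations of a
quadratic Morse function.**  With `f w = ∑ i, (-1)^(ε i) * (w i)^2 + c`, `0 < r < 1`,
`g, h` two `C²` functions with `‖g - f‖_{2,B(r)} < r/n` and `‖h - f‖_{2,B(r)} < r/n`
(stated pointwise), `x_g, x_h ∈ B(r)` critical points of `g`, `h` respectively, both
lying in a convex set `U ⊆ B(r)`, one has `‖x_g - x_h‖ ≤ √n * ‖g - h‖_{1,U}`
(stated via an arbitrary upper bound `C` of the `C¹`-norm of `g - h` on `U`). -/
theorem stmt_1 (n : ℕ) (hn : 1 ≤ n) (r c : ℝ) (hr0 : 0 < r) (hr1 : r < 1)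
    (ε : Fin n → ℕ) (hε : ∀ i, ε i ≤ 1)
    (f g h : EuclideanSpace ℝ (Fin n) → ℝ)
    (hf : ∀ w, f w = (∑ i, (-1 : ℝ) ^ (ε i) * (w i) ^ 2) + c)
    (hg : ContDiff ℝ 2 g) (hh : ContDiff ℝ 2 h)
    (hgclose : ∀ x ∈ Metric.ball (0 : EuclideanSpace ℝ (Fin n)) r,
      |g x - f x| + ‖fderiv ℝ g x - fderiv ℝ f x‖
        + ‖iteratedFDeriv ℝ 2 g x - iteratedFDeriv ℝ 2 f x‖ < r / n)
    (hhclose : ∀ x ∈ Metric.ball (0 : EuclideanSpace ℝ (Fin n)) r,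
      |h x - f x| + ‖fderiv ℝ h x - fderiv ℝ f x‖
        + ‖iteratedFDeriv ℝ 2 h x - iteratedFDeriv ℝ 2 f x‖ < r / n)
    (U : Set (EuclideanSpace ℝ (Fin n))) (hU : Convex ℝ U)
    (hUball : U ⊆ Metric.ball (0 : EuclideanSpace ℝ (Fin n)) r)
    (xg xh : EuclideanSpace ℝ (Fin n))
    (hxg : xg ∈ Metric.ball (0 : EuclideanSpace ℝ (Fin n)) r)
    (hxh : xh ∈ Metric.ball (0 : EuclideanSpace ℝ (Fin n)) r)
    (hcg : fderiv ℝ g xg = 0) (hch : fderiv ℝ h xh = 0)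
    (hxgU : xg ∈ U) (hxhU : xh ∈ U)
    (C : ℝ) (hC : ∀ x ∈ U, |g x - h x| + ‖fderiv ℝ g x - fderiv ℝ h x‖ ≤ C) :
    ‖xg - xh‖ ≤ Real.sqrt n * C := by
  have hfe : f = fun w => (∑ i, (-1 : ℝ) ^ (ε i) * (w i) ^ 2) + c := funext hf
  have hfC : ContDiff ℝ 2 f := by
    rw [hfe]; fun_prop
  have hproj : ∀ (x : EuclideanSpace ℝ (Fin n)) (i : Fin n),
      HasFDerivAt (fun w : EuclideanSpace ℝ (Fin n) => w i)
        (EuclideanSpace.proj i : EuclideanSpace ℝ (Fin n) →L[ℝ] ℝ) x := fun x i =>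
    (EuclideanSpace.proj i : EuclideanSpace ℝ (Fin n) →L[ℝ] ℝ).hasFDerivAt
  have hfd : ∀ x v, fderiv ℝ f x v = ∑ i, (-1 : ℝ) ^ (ε i) * (2 * x i * v i) := by
    intro x v
    have h1 : HasFDerivAt f (∑ i, (-1 : ℝ) ^ (ε i) •
        ((2 * x i) • (EuclideanSpace.proj i : EuclideanSpace ℝ (Fin n) →L[ℝ] ℝ))) x := by
      rw [hfe]
      refine HasFDerivAt.add_const c (HasFDerivAt.fun_sum fun i _ => ?_)
      have h2 := ((hproj x i).pow 2).const_mul ((-1 : ℝ) ^ (ε i))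
      simpa using h2
    rw [h1.fderiv]
    simp [ContinuousLinearMap.sum_apply]
  have hφC : ContDiff ℝ 2 (g - f) := hg.sub hfC
  have hφd : ∀ x, fderiv ℝ (g - f) x = fderiv ℝ g x - fderiv ℝ f x := fun x =>
    fderiv_sub (hg.differentiable (by norm_num) x) (hfC.differentiable (by norm_num) x)
  have hrn : r / n ≤ 1 := by
    have : (1 : ℝ) ≤ n := by exact_mod_cast hn
    rw [div_le_one (by linarith)]; linarith
  have hbd : ∀ x ∈ Metric.ball (0 : EuclideanSpace ℝ (Fin n)) r,
      ‖fderiv ℝ (fderiv ℝ (g - f)) x‖ ≤ 1 := by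
    intro x hx
    have h1 := hgclose x hx
    have h2 : iteratedFDeriv ℝ 2 (g - f) x = iteratedFDeriv ℝ 2 g x - iteratedFDeriv ℝ 2 f x :=
      iteratedFDeriv_sub_apply hg.contDiffAt hfC.contDiffAt
    have h3 : ‖fderiv ℝ (fderiv ℝ (g - f)) x‖ = ‖iteratedFDeriv ℝ 2 (g - f) x‖ := by
      rw [← norm_iteratedFDeriv_one, norm_iteratedFDeriv_fderiv]
    rw [h3, h2]
    have := abs_nonneg (g x - f x)
    have := norm_nonneg (fderiv ℝ g x - fderiv ℝ f x)
    linarith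
  have hdφ : Differentiable ℝ (fderiv ℝ (g - f)) :=
    (hφC.fderiv_right (m := 1) (by norm_num)).differentiable (by norm_num)
  have hlip := (convex_ball (0 : EuclideanSpace ℝ (Fin n)) r).norm_image_sub_le_of_norm_fderiv_le
    (fun x _ => hdφ x) hbd hxh hxg
  rw [hφd, hφd, hcg, one_mul] at hlip
  have hCh := hC xh hxhU
  rw [hch, sub_zero] at hCh
  have hC1 : ‖fderiv ℝ g xh‖ ≤ C := by
    have := abs_nonneg (g xh - h xh)
    linarith
  have hF : ‖fderiv ℝ f xg - fderiv ℝ f xh‖ ≤ ‖xg - xh‖ + C := by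
    have e : fderiv ℝ f xg - fderiv ℝ f xh =
      -((0 - fderiv ℝ f xg) - (fderiv ℝ g xh - fderiv ℝ f xh)) - fderiv ℝ g xh := by abel
    rw [e]
    refine (norm_sub_le _ _).trans ?_
    rw [norm_neg]
    linarith
  have hsq : ∀ i, ((-1 : ℝ) ^ (ε i)) * ((-1 : ℝ) ^ (ε i)) = 1 := fun i => by
    rw [← mul_pow]; norm_num
  let v : EuclideanSpace ℝ (Fin n) := WithLp.toLp 2 fun i => (-1 : ℝ) ^ (ε i) * (xg i - xh i)
  have hv : ‖v‖ = ‖xg - xh‖ := by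
    simp [EuclideanSpace.norm_eq, v, abs_mul]
  have hval : (fderiv ℝ f xg - fderiv ℝ f xh) v = 2 * ‖xg - xh‖ ^ 2 := by
    rw [ContinuousLinearMap.sub_apply, hfd, hfd, EuclideanSpace.real_norm_sq_eq,
      ← Finset.sum_sub_distrib, Finset.mul_sum]
    refine Finset.sum_congr rfl fun i _ => ?_
    simp only [v, PiLp.sub_apply]
    linear_combination (2 * (xg i - xh i) ^ 2) * hsq i
  have hop := (le_abs_self _).trans ((fderiv ℝ f xg - fderiv ℝ f xh).le_opNorm v)
  rw [hval, hv] at hop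
  have hC0 : 0 ≤ C := (norm_nonneg _).trans hC1
  have hd : ‖xg - xh‖ ≤ C := by
    rcases (norm_nonneg (xg - xh)).eq_or_lt with h0 | h0
    · rw [← h0]; exact hC0
    · nlinarith [mul_le_mul_of_nonneg_right hF h0.le]
  have hsn : 1 ≤ Real.sqrt n := by
    rw [Real.one_le_sqrt]; exact_mod_cast hn
  nlinarith
end

section
/- Let n ≥ 1 be an integer, 0 < r < 1, c ∈ ℝ, ε_1,…,ε_n ∈ {0,1}, and f(w) = Σ_{i=1}^n (−1)^{ε_i} w_i² + c on ℝⁿ. Suppose g, h : ℝⁿ → ℝ are C² functions with ‖g − f‖_{2,B(r)} < r/n and ‖h − f‖_{2,B(r)} < r/n, let x_g ∈ B(r) and x_h ∈ B(r) be critical points of g and of h respectively with corresponding critical values y_g = g(x_g) and y_h = h(x_h), and suppose x_g and x_h both lie in a convex set U ⊆ B(r). Then |y_g − y_h| ≤ (√n · ‖g‖_{1,U} + 1) · ‖g − h‖_{1,U}. -/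
/-- **Estimate on the distance between critical values of two small perturbations of a
quadratic Morse function.**  With `f w = ∑ i, (-1)^(ε i) * (w i)^2 + c`, `0 < r < 1`,
`g, h` two `C²` functions with `‖g - f‖_{2,B(r)} < r/n` and `‖h - f‖_{2,B(r)} < r/n`
(stated pointwise), `x_g, x_h ∈ B(r)` critical points of `g`, `h` with critical values
`y_g = g x_g`, `y_h = h x_h`, both critical points lying in a convex set `U ⊆ B(r)`,
one has `|y_g - y_h| ≤ (√n * ‖g‖_{1,U} + 1) * ‖g - h‖_{1,U}` (stated via arbitrary
upper bounds `C₁`, `C₂` of the `C¹`-norms of `g` and of `g - h` on `U`). -/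
theorem stmt_2 (n : ℕ) (hn : 1 ≤ n) (r c : ℝ) (hr0 : 0 < r) (hr1 : r < 1)
    (ε : Fin n → ℕ) (hε : ∀ i, ε i ≤ 1)
    (f g h : EuclideanSpace ℝ (Fin n) → ℝ)
    (hf : ∀ w, f w = (∑ i, (-1 : ℝ) ^ (ε i) * (w i) ^ 2) + c)
    (hg : ContDiff ℝ 2 g) (hh : ContDiff ℝ 2 h)
    (hgclose : ∀ x ∈ Metric.ball (0 : EuclideanSpace ℝ (Fin n)) r,
      |g x - f x| + ‖fderiv ℝ g x - fderiv ℝ f x‖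
        + ‖iteratedFDeriv ℝ 2 g x - iteratedFDeriv ℝ 2 f x‖ < r / n)
    (hhclose : ∀ x ∈ Metric.ball (0 : EuclideanSpace ℝ (Fin n)) r,
      |h x - f x| + ‖fderiv ℝ h x - fderiv ℝ f x‖
        + ‖iteratedFDeriv ℝ 2 h x - iteratedFDeriv ℝ 2 f x‖ < r / n)
    (U : Set (EuclideanSpace ℝ (Fin n))) (hU : Convex ℝ U)
    (hUball : U ⊆ Metric.ball (0 : EuclideanSpace ℝ (Fin n)) r)
    (xg xh : EuclideanSpace ℝ (Fin n))
    (hxg : xg ∈ Metric.ball (0 : EuclideanSpace ℝ (Fin n)) r)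
    (hxh : xh ∈ Metric.ball (0 : EuclideanSpace ℝ (Fin n)) r)
    (hcg : fderiv ℝ g xg = 0) (hch : fderiv ℝ h xh = 0)
    (hxgU : xg ∈ U) (hxhU : xh ∈ U)
    (C₁ C₂ : ℝ)
    (hC₁ : ∀ x ∈ U, |g x| + ‖fderiv ℝ g x‖ ≤ C₁)
    (hC₂ : ∀ x ∈ U, |g x - h x| + ‖fderiv ℝ g x - fderiv ℝ h x‖ ≤ C₂) :
    |g xg - h xh| ≤ (Real.sqrt n * C₁ + 1) * C₂ := by
  set v : EuclideanSpace ℝ (Fin n) := xh - xg with hv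
  have hs : ∀ i, ((-1 : ℝ) ^ (ε i)) * ((-1 : ℝ) ^ (ε i)) = 1 := by
    intro i
    rw [← mul_pow]; norm_num
  have hfd : ∀ x, HasFDerivAt f (∑ i, ((-1 : ℝ) ^ (ε i)) • ((2 * x i) •
      (EuclideanSpace.proj i : EuclideanSpace ℝ (Fin n) →L[ℝ] ℝ))) x := by
    intro x
    have e : f = fun w => (∑ i, (-1 : ℝ) ^ (ε i) * (w i) ^ 2) + c := funext hf
    rw [e]
    refine HasFDerivAt.add_const c (HasFDerivAt.fun_sum fun i _ => ?_)
    refine HasFDerivAt.const_mul ?_ _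
    have h1 : HasFDerivAt (fun w : EuclideanSpace ℝ (Fin n) => w i)
        (EuclideanSpace.proj i : EuclideanSpace ℝ (Fin n) →L[ℝ] ℝ) x :=
      (EuclideanSpace.proj i : EuclideanSpace ℝ (Fin n) →L[ℝ] ℝ).hasFDerivAt
    have h2 := h1.pow 2
    simpa using h2
  have hfc : ContDiff ℝ 2 f := by
    have e : f = fun w => (∑ i, (-1 : ℝ) ^ (ε i) * (w i) ^ 2) + c := funext hf
    rw [e]
    fun_prop
  have hφ : ContDiff ℝ 2 (g - f) := hg.sub hfc
  have hφd : Differentiable ℝ (fderiv ℝ (g - f)) :=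
    (hφ.fderiv_right (m := 1) (by norm_num)).differentiable (by norm_num)
  have hrn : r / n ≤ 1 := by
    have : (1 : ℝ) ≤ n := by exact_mod_cast hn
    rw [div_le_one (by linarith)]; linarith
  have hbound : ∀ x ∈ Metric.ball (0 : EuclideanSpace ℝ (Fin n)) r,
      ‖fderiv ℝ (fderiv ℝ (g - f)) x‖ ≤ 1 := by
    intro x hx
    have h1 := hgclose x hx
    have h2 : iteratedFDeriv ℝ 2 (g - f) x = iteratedFDeriv ℝ 2 g x - iteratedFDeriv ℝ 2 f x :=
      iteratedFDeriv_sub_apply hg.contDiffAt hfc.contDiffAt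
    have h3 : ‖fderiv ℝ (fderiv ℝ (g - f)) x‖ = ‖iteratedFDeriv ℝ 2 (g - f) x‖ := by
      rw [← norm_iteratedFDeriv_fderiv, norm_iteratedFDeriv_one]
    rw [h3, h2]
    have := abs_nonneg (g x - f x)
    have := norm_nonneg (fderiv ℝ g x - fderiv ℝ f x)
    linarith
  have hlip : ‖fderiv ℝ (g - f) xh - fderiv ℝ (g - f) xg‖ ≤ 1 * ‖xh - xg‖ :=
    (convex_ball _ _).norm_image_sub_le_of_norm_fderiv_le (fun x _ => hφd x) hbound hxg hxh
  have hgdiff : Differentiable ℝ g := hg.differentiable (by norm_num)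
  have hsub : ∀ x, fderiv ℝ (g - f) x = fderiv ℝ g x - fderiv ℝ f x := fun x =>
    fderiv_sub (hgdiff x) (hfd x).differentiableAt
  have hgxh : ‖fderiv ℝ g xh‖ ≤ C₂ := by
    have := hC₂ xh hxhU
    rw [hch, sub_zero] at this
    linarith [abs_nonneg (g xh - h xh)]
  have hghx : |g xh - h xh| ≤ C₂ := by
    linarith [hC₂ xh hxhU, norm_nonneg (fderiv ℝ g xh - fderiv ℝ h xh)]
  let w : EuclideanSpace ℝ (Fin n) := WithLp.toLp 2 fun i => (-1 : ℝ) ^ (ε i) * v i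
  have hwi : ∀ i, w i = (-1 : ℝ) ^ (ε i) * v i := fun i => rfl
  have hw : ‖w‖ = ‖v‖ := by
    rw [EuclideanSpace.norm_eq, EuclideanSpace.norm_eq]
    congr 1
    refine Finset.sum_congr rfl fun i _ => ?_
    rw [hwi, norm_mul, norm_pow]; simp
  have hfw : (fderiv ℝ f xh - fderiv ℝ f xg) w = 2 * ‖v‖ ^ 2 := by
    rw [(hfd xh).fderiv, (hfd xg).fderiv, EuclideanSpace.norm_sq_eq, ← Finset.sum_sub_distrib,
      ContinuousLinearMap.sum_apply, Finset.mul_sum]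
    refine Finset.sum_congr rfl fun i _ => ?_
    have hpw : (EuclideanSpace.proj i : EuclideanSpace ℝ (Fin n) →L[ℝ] ℝ) w
        = (-1 : ℝ) ^ (ε i) * v i := rfl
    have hvi : v i = xh i - xg i := rfl
    simp only [ContinuousLinearMap.sub_apply, ContinuousLinearMap.smul_apply, smul_eq_mul,
      hpw, Real.norm_eq_abs, sq_abs]
    rw [hvi]
    linear_combination (2 * (xh i - xg i) ^ 2) * hs i
  have hnorm : ‖fderiv ℝ f xh - fderiv ℝ f xg‖ ≤ C₂ + ‖v‖ := by
    have e : fderiv ℝ f xh - fderiv ℝ f xg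
        = fderiv ℝ g xh - (fderiv ℝ (g - f) xh - fderiv ℝ (g - f) xg) := by
      rw [hsub, hsub, hcg]; abel
    rw [e]
    refine (norm_sub_le _ _).trans ?_
    linarith
  have hv2 : 2 * ‖v‖ ^ 2 ≤ (C₂ + ‖v‖) * ‖v‖ := by
    rw [← hfw]
    refine (le_abs_self _).trans ?_
    have := (fderiv ℝ f xh - fderiv ℝ f xg).le_opNorm w
    rw [hw, Real.norm_eq_abs] at this
    exact this.trans (mul_le_mul_of_nonneg_right hnorm (norm_nonneg _))
  have hC20 : 0 ≤ C₂ := (abs_nonneg _).trans hghx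
  have hvC : ‖v‖ ≤ C₂ := by
    by_contra hcon
    push Not at hcon
    nlinarith
  have hC10 : 0 ≤ C₁ := by
    linarith [hC₁ xh hxhU, norm_nonneg (fderiv ℝ g xh), abs_nonneg (g xh)]
  have hgg : ‖g xh - g xg‖ ≤ C₁ * ‖xh - xg‖ :=
    hU.norm_image_sub_le_of_norm_fderiv_le (fun x _ => hgdiff x)
      (fun x hx => by linarith [hC₁ x hx, abs_nonneg (g x)]) hxgU hxhU
  have hsq : 1 ≤ Real.sqrt n := by
    rw [Real.one_le_sqrt]; exact_mod_cast hn
  have htri : |g xg - h xh| ≤ |g xh - g xg| + |g xh - h xh| := by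
    rw [abs_sub_comm (g xh) (g xg)]
    exact abs_sub_le _ _ _
  rw [Real.norm_eq_abs] at hgg
  have h1 : C₁ * ‖xh - xg‖ ≤ C₁ * C₂ := mul_le_mul_of_nonneg_left hvC hC10
  have h2 : 1 * (C₁ * C₂) ≤ Real.sqrt n * (C₁ * C₂) :=
    mul_le_mul_of_nonneg_right hsq (mul_nonneg hC10 hC20)
  nlinarith
end

section
/- Every critical point of F is nondegenerate: for every x ∈ ℝ, if F′(x) = 0 then F″(x) ≠ 0. -/
/-- Every critical point of `F x = exp (-x²) * sin x` is nondegenerate. -/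
theorem stmt_3 (F : ℝ → ℝ) (hF : ∀ x, F x = Real.exp (-x ^ 2) * Real.sin x) :
    ∀ x : ℝ, deriv F x = 0 → deriv (deriv F) x ≠ 0 := by
  have hE : ∀ x : ℝ, HasDerivAt (fun y : ℝ => Real.exp (-y ^ 2))
      (Real.exp (-x ^ 2) * (-(2 * x))) x := by
    intro x
    have h := ((hasDerivAt_pow 2 x).fun_neg).exp
    convert h using 1
    norm_num
  have h1 : deriv F = fun x => Real.exp (-x ^ 2) * (Real.cos x - 2 * x * Real.sin x) := by
    have hF' : F = fun x => Real.exp (-x ^ 2) * Real.sin x := funext hF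
    funext x
    rw [hF', ((hE x).fun_mul (Real.hasDerivAt_sin x)).deriv]
    ring
  intro x hx h2
  have hl : HasDerivAt (fun y : ℝ => 2 * y) 2 x := by
    simpa using (hasDerivAt_id x).const_mul (2 : ℝ)
  have hd := (hE x).fun_mul
    ((Real.hasDerivAt_cos x).fun_sub (hl.fun_mul (Real.hasDerivAt_sin x)))
  rw [h1, hd.deriv] at h2
  rw [h1] at hx
  have he := Real.exp_ne_zero (-x ^ 2)
  have hc : Real.cos x - 2 * x * Real.sin x = 0 := (mul_eq_zero.mp hx).resolve_left he
  rw [hc, mul_zero, zero_add] at h2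
  have h3 := (mul_eq_zero.mp h2).resolve_left he
  have hc' : Real.cos x = 2 * x * Real.sin x := by linarith
  have h4 : (3 + 4 * x ^ 2) * Real.sin x = 0 := by
    rw [hc'] at h3
    linarith
  have hs : Real.sin x = 0 := (mul_eq_zero.mp h4).resolve_left (by positivity)
  have h5 := Real.sin_sq_add_cos_sq x
  rw [hc', hs] at h5
  norm_num at h5
end

section
/- F restricted to its set of critical points is injective: for all a, b ∈ ℝ, if F′(a) = 0, F′(b) = 0, and F(a) = F(b), then a = b. -/
theorem aux_crit (F : ℝ → ℝ) (hF : ∀ x, F x = Real.exp (-x ^ 2) * Real.sin x)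
    (x : ℝ) (h : deriv F x = 0) : Real.sin x ^ 2 * (1 + 4 * x ^ 2) = 1 := by
  have hFe : F = fun x => Real.exp (-x ^ 2) * Real.sin x := funext hF
  have hd : HasDerivAt F (Real.exp (-x ^ 2) * (-(2 * x)) * Real.sin x
      + Real.exp (-x ^ 2) * Real.cos x) x := by
    rw [hFe]
    have h1 : HasDerivAt (fun x : ℝ => -x ^ 2) (-(2 * x)) x := by
      simpa using (hasDerivAt_pow 2 x).fun_neg
    exact h1.exp.mul (Real.hasDerivAt_sin x)
  rw [hd.deriv] at h
  have h2 : Real.exp (-x ^ 2) * (Real.cos x - 2 * x * Real.sin x) = 0 := by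
    linear_combination h
  have h3 := (mul_eq_zero.mp h2).resolve_left (Real.exp_pos _).ne'
  linear_combination Real.sin_sq_add_cos_sq x
    - (Real.cos x + 2 * x * Real.sin x) * h3

theorem aux_lt (F : ℝ → ℝ) (hF : ∀ x, F x = Real.exp (-x ^ 2) * Real.sin x)
    (a b : ℝ) (ha : deriv F a = 0) (hb : deriv F b = 0) (hlt : a ^ 2 < b ^ 2) :
    F b ^ 2 < F a ^ 2 := by
  have h1 := aux_crit F hF a ha
  have h2 := aux_crit F hF b hb
  have hE : Real.exp (-b ^ 2) < Real.exp (-a ^ 2) := Real.exp_lt_exp.mpr (by linarith)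
  have hs : Real.sin b ^ 2 < Real.sin a ^ 2 := by
    by_contra hc
    push Not at hc
    have hbp : 0 < Real.sin b ^ 2 := by
      rcases (sq_nonneg (Real.sin b)).eq_or_lt with h | h
      · rw [← h] at h2; norm_num at h2
      · exact h
    nlinarith [mul_pos hbp (sub_pos.mpr hlt),
      mul_nonneg (sub_nonneg.mpr hc) (sq_nonneg a)]
  rw [hF a, hF b, mul_pow, mul_pow]
  have hE2 : Real.exp (-b ^ 2) ^ 2 < Real.exp (-a ^ 2) ^ 2 :=
    pow_lt_pow_left₀ hE (Real.exp_pos _).le two_ne_zero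
  exact mul_lt_mul'' hE2 hs (sq_nonneg _) (sq_nonneg _)

/-- `F x = exp (-x²) * sin x` is injective on its set of critical points. -/
theorem stmt_4 (F : ℝ → ℝ) (hF : ∀ x, F x = Real.exp (-x ^ 2) * Real.sin x) :
    ∀ a b : ℝ, deriv F a = 0 → deriv F b = 0 → F a = F b → a = b := by
  intro a b ha hb hab
  rcases lt_trichotomy (a ^ 2) (b ^ 2) with h | h | h
  · have := aux_lt F hF a b ha hb h
    rw [hab] at this
    exact absurd this (lt_irrefl _)
  · rcases sq_eq_sq_iff_eq_or_eq_neg.mp h with h | h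
    · exact h
    · exfalso
      have h2 := aux_crit F hF b hb
      rw [h, hF, hF, Real.sin_neg, neg_sq] at hab
      have h3 : Real.exp (-b ^ 2) * Real.sin b = 0 := by linarith
      have h4 := (mul_eq_zero.mp h3).resolve_left (Real.exp_pos _).ne'
      rw [h4] at h2
      norm_num at h2
  · have := aux_lt F hF b a hb ha h
    rw [hab] at this
    exact absurd this (lt_irrefl _)
end

section
/- Let n ≥ 1, let ε_1,…,ε_n ∈ {0,1}, and let f : ℝⁿ → ℝ be the quadratic Morse function f(x) = Σ_{i=1}^n (−1)^{ε_i} x_i². Let k ≥ 1 and let h : ℝⁿ → ℝ be a smooth function all of whose derivatives of order ≤ k vanish at the origin (i.e., h(0) = 0 and D^m h(0) = 0 for 1 ≤ m ≤ k). Then there exist smooth functions ξ_1,…,ξ_n : ℝⁿ → ℝ, all of whose derivatives of order ≤ k−1 vanish at the origin, such that Σ_{i=1}^n (∂f/∂x_i)(x) · ξ_i(x) = h(x) for all x, i.e., Σ_{i=1}^n 2(−1)^{ε_i} x_i ξ_i(x) = h(x). -/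
open MeasureTheory in
/-- Derivative of the averaged function `x ↦ ∫ t in 0..1, t ^ p • g (t • x)`. -/
theorem hadamard_hasFDerivAt {E F : Type} [NormedAddCommGroup E] [NormedSpace ℝ E]
    [FiniteDimensional ℝ E] [NormedAddCommGroup F] [NormedSpace ℝ F]
    (g : E → F) (hg : ContDiff ℝ 1 g) (p : ℕ) (x₀ : E) :
    HasFDerivAt (fun x : E => ∫ t in (0 : ℝ)..1, t ^ p • g (t • x))
      (∫ t in (0 : ℝ)..1, t ^ (p + 1) • fderiv ℝ g (t • x₀)) x₀ := by
  have hgc : Continuous g := hg.continuous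
  have hdc : Continuous (fderiv ℝ g) := hg.continuous_fderiv (by simp)
  have : ProperSpace E := FiniteDimensional.proper ℝ E
  have hcont : Continuous (fun q : E × ℝ => q.2 ^ (p + 1) • fderiv ℝ g (q.2 • q.1)) := by
    fun_prop
  obtain ⟨C, hC⟩ := ((isCompact_closedBall x₀ 1).prod
    (isCompact_Icc (a := (0 : ℝ)) (b := 1))).exists_bound_of_continuousOn hcont.continuousOn
  refine intervalIntegral.hasFDerivAt_integral_of_dominated_of_fderiv_le
    (F := fun (x : E) (t : ℝ) => t ^ p • g (t • x))
    (F' := fun (x : E) (t : ℝ) => t ^ (p + 1) • fderiv ℝ g (t • x))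
    (bound := fun _ => C)
    (Metric.ball_mem_nhds x₀ one_pos) ?_ ?_ ?_ ?_ ?_ ?_
  · refine Filter.Eventually.of_forall fun x => ?_
    exact (show Continuous (fun t : ℝ => t ^ p • g (t • x)) by fun_prop).aestronglyMeasurable
  · exact (show Continuous (fun t : ℝ => t ^ p • g (t • x₀)) by fun_prop).intervalIntegrable _ _
  · exact (show Continuous (fun t : ℝ => t ^ (p + 1) • fderiv ℝ g (t • x₀)) by
      fun_prop).aestronglyMeasurable
  · refine Filter.Eventually.of_forall fun t ht x hx => ?_
    rw [Set.uIoc_of_le zero_le_one] at ht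
    exact hC (x, t) ⟨Metric.ball_subset_closedBall hx, ht.1.le, ht.2⟩
  · exact _root_.intervalIntegrable_const
  · refine Filter.Eventually.of_forall fun t ht x hx => ?_
    have h1 : HasFDerivAt (fun x : E => t • x) (t • ContinuousLinearMap.id ℝ E) x :=
      (hasFDerivAt_id x).const_smul t
    have h2 := ((hg.differentiable (by simp) (t • x)).hasFDerivAt.comp x h1).const_smul (t ^ p)
    have e : t ^ (p + 1) • fderiv ℝ g (t • x)
        = t ^ p • (fderiv ℝ g (t • x)).comp (t • ContinuousLinearMap.id ℝ E) := by
      ext v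
      simp [pow_succ, smul_smul]
    rw [e]
    exact h2

theorem hadamard_contDiff {E : Type} [NormedAddCommGroup E] [NormedSpace ℝ E]
    [FiniteDimensional ℝ E] (m : ℕ) :
    ∀ {F : Type} [NormedAddCommGroup F] [NormedSpace ℝ F]
    (g : E → F) (_ : ContDiff ℝ (⊤ : ℕ∞) g) (p : ℕ),
    ContDiff ℝ m (fun x : E => ∫ t in (0 : ℝ)..1, t ^ p • g (t • x)) := by
  induction m with
  | zero =>
    intro F _ _ g hg p
    have h1 : ContDiff ℝ 1 g := hg.of_le (by exact_mod_cast le_top)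
    rw [Nat.cast_zero, contDiff_zero, continuous_iff_continuousAt]
    exact fun x => (hadamard_hasFDerivAt g h1 p x).continuousAt
  | succ m ih =>
    intro F _ _ g hg p
    have h1 : ContDiff ℝ 1 g := hg.of_le (by exact_mod_cast le_top)
    rw [Nat.cast_succ, contDiff_succ_iff_hasFDerivAt]
    exact ⟨_, ih (fderiv ℝ g) (hg.fderiv_right (by simp)) (p + 1),
      fun x => hadamard_hasFDerivAt g h1 p x⟩

theorem hadamard_jet {E : Type} [NormedAddCommGroup E] [NormedSpace ℝ E]
    [FiniteDimensional ℝ E] (m : ℕ) :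
    ∀ {F : Type} [NormedAddCommGroup F] [NormedSpace ℝ F]
    (g : E → F) (_ : ContDiff ℝ (⊤ : ℕ∞) g) (_ : iteratedFDeriv ℝ m g 0 = 0) (p : ℕ),
    iteratedFDeriv ℝ m (fun x : E => ∫ t in (0 : ℝ)..1, t ^ p • g (t • x)) 0 = 0 := by
  induction m with
  | zero =>
    intro F _ _ g hg h0 p
    have h0' : g 0 = 0 := by
      rw [← norm_eq_zero, ← norm_iteratedFDeriv_zero (𝕜 := ℝ), h0, norm_zero]
    rw [← norm_eq_zero, norm_iteratedFDeriv_zero]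
    simp [h0']
  | succ m ih =>
    intro F _ _ g hg h0 p
    have h1 : ContDiff ℝ 1 g := hg.of_le (by exact_mod_cast le_top)
    have hd : iteratedFDeriv ℝ m (fderiv ℝ g) 0 = 0 := by
      rw [← norm_eq_zero, norm_iteratedFDeriv_fderiv, h0, norm_zero]
    have := ih (fderiv ℝ g) (hg.fderiv_right (by simp)) hd (p + 1)
    rw [← norm_eq_zero, ← norm_iteratedFDeriv_fderiv,
      show fderiv ℝ (fun x : E => ∫ t in (0 : ℝ)..1, t ^ p • g (t • x)) = _ from
        funext fun x => (hadamard_hasFDerivAt g h1 p x).fderiv, this, norm_zero]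

/-- For the quadratic Morse function `f x = ∑ i, (-1)^(ε i) * x i ^ 2` and a smooth
function `h` whose derivatives of order `≤ k` all vanish at the origin, there exist
smooth functions `ξ₁, …, ξₙ`, whose derivatives of order `≤ k - 1` all vanish at the
origin, with `∑ i, (∂f/∂xᵢ) x * ξ i x = h x`, i.e.
`∑ i, 2 * (-1)^(ε i) * x i * ξ i x = h x`. -/
theorem stmt_16 (n : ℕ) (hn : 1 ≤ n) (ε : Fin n → ℕ) (hε : ∀ i, ε i ≤ 1)
    (k : ℕ) (hk : 1 ≤ k)
    (h : EuclideanSpace ℝ (Fin n) → ℝ) (hsm : ContDiff ℝ (⊤ : ℕ∞) h)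
    (hjet : ∀ m : ℕ, m ≤ k → iteratedFDeriv ℝ m h 0 = 0) :
    ∃ ξ : Fin n → EuclideanSpace ℝ (Fin n) → ℝ,
      (∀ i, ContDiff ℝ (⊤ : ℕ∞) (ξ i)) ∧
      (∀ i, ∀ m : ℕ, m ≤ k - 1 → iteratedFDeriv ℝ m (ξ i) 0 = 0) ∧
      ∀ x, (∑ i, 2 * (-1 : ℝ) ^ (ε i) * x i * ξ i x) = h x := by
  have h1 : ContDiff ℝ 1 h := hsm.of_le (by exact_mod_cast le_top)
  have hd : ContDiff ℝ (⊤ : ℕ∞) (fderiv ℝ h) := hsm.fderiv_right (by simp)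
  have hdc : Continuous (fderiv ℝ h) := hd.continuous
  set G : EuclideanSpace ℝ (Fin n) → (EuclideanSpace ℝ (Fin n) →L[ℝ] ℝ) :=
    fun x => ∫ t in (0 : ℝ)..1, t ^ 0 • fderiv ℝ h (t • x) with hG
  have hGs : ContDiff ℝ (⊤ : ℕ∞) G :=
    contDiff_infty.2 fun m => hadamard_contDiff m _ hd 0
  have hGjet : ∀ m : ℕ, m ≤ k - 1 → iteratedFDeriv ℝ m G 0 = 0 := by
    intro m hm
    refine hadamard_jet m _ hd ?_ 0
    rw [← norm_eq_zero, norm_iteratedFDeriv_fderiv, hjet (m + 1) (by omega), norm_zero]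
  have h00 : h 0 = 0 := by
    rw [← norm_eq_zero, ← norm_iteratedFDeriv_zero (𝕜 := ℝ), hjet 0 (by omega), norm_zero]
  have hGx : ∀ x, G x x = h x := by
    intro x
    have hcont : Continuous (fun t : ℝ => fderiv ℝ h (t • x)) := by fun_prop
    have e1 : G x x = ∫ t in (0 : ℝ)..1, fderiv ℝ h (t • x) x := by
      simp only [hG, pow_zero, one_smul]
      rw [ContinuousLinearMap.intervalIntegral_apply (hcont.intervalIntegrable _ _)]
    rw [e1, intervalIntegral.integral_eq_sub_of_hasDerivAt (f := fun t : ℝ => h (t • x))]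
    · simp [h00]
    · intro t _
      have h2 : HasDerivAt (fun t : ℝ => t • x) x t := by
        simpa using (hasDerivAt_id t).smul_const x
      exact (h1.differentiable (by simp) (t • x)).hasFDerivAt.comp_hasDerivAt t h2
    · exact (show Continuous (fun t : ℝ => fderiv ℝ h (t • x) x) by fun_prop).intervalIntegrable _ _
  -- evaluation functionals
  let L : Fin n → ((EuclideanSpace ℝ (Fin n) →L[ℝ] ℝ) →L[ℝ] ℝ) := fun i =>
    ((1 / 2 : ℝ) * (-1) ^ (ε i)) •
      ContinuousLinearMap.apply ℝ ℝ (EuclideanSpace.single i (1 : ℝ))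
  refine ⟨fun i => L i ∘ G, fun i => (L i).contDiff.comp hGs, ?_, ?_⟩
  · intro i m hm
    rw [ContinuousLinearMap.iteratedFDeriv_comp_left (L i) hGs.contDiffAt
      (by exact_mod_cast le_top), hGjet m hm]
    ext v
    simp
  · intro x
    have hx : x = ∑ i, x i • EuclideanSpace.single i (1 : ℝ) := by
      ext j
      simp [Finset.sum_apply, Pi.single_apply]
    conv_rhs => rw [← hGx x]
    conv_rhs => arg 2; rw [hx]
    rw [map_sum]
    refine Finset.sum_congr rfl fun i _ => ?_
    have hs : ((-1 : ℝ) ^ (ε i)) * (-1) ^ (ε i) = 1 := by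
      rw [← mul_pow]; simp
    simp only [L, Function.comp, ContinuousLinearMap.smul_apply,
      ContinuousLinearMap.apply_apply, map_smul, smul_eq_mul]
    linear_combination (x i * G x (EuclideanSpace.single i 1)) * hs
end
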